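/- Let G be a network (a finite, strongly connected directed multigraph without self-loops) with a deadlock-free routing scheme, and let ≤ be a linear order on E that respects the routing scheme and whose attraction number is minimal among all linear orders on E respecting the routing scheme. Then the attraction subgraph of ≤ has exactly one global attractor. -/

import Mathlib

/-- `p` is a directed path from `u` to `w` in the directed multigraph given by
`src, tgt : E → V`: a nonempty list of edges where the target of each edge equals the
source of the next, starting at `u` and ending at `w`. -/
def IsPathFrom {V E : Type*} (src tgt : E → V) (u w : V) (p : List E) : Prop :=
  p ≠ [] ∧ p.Chain' (fun e₁ e₂ => tgt e₁ = src e₂) ∧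
    p.head?.map src = some u ∧ p.getLast?.map tgt = some w

/-- `w` is reachable from `u` by a directed path using only edges from `A`. -/
def ReachableVia {V E : Type*} (src tgt : E → V) (A : Set E) (u w : V) : Prop :=
  ∃ p : List E, (∀ e ∈ p, e ∈ A) ∧ IsPathFrom src tgt u w p

/-- The graph is strongly connected: every vertex reaches every other vertex. -/
def StronglyConnected {V E : Type*} (src tgt : E → V) : Prop :=
  ∀ u w : V, u ≠ w → ReachableVia src tgt Set.univ u w

/-- `route` is a routing scheme: it assigns to every ordered pair of distinct vertices
a directed path between them. -/
def IsRouting {V E : Type*} (src tgt : E → V) (route : ∀ u w : V, u ≠ w → List E) : Prop :=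
  ∀ (u w : V) (h : u ≠ w), IsPathFrom src tgt u w (route u w h)

/-- The dependency relation of a routing scheme: `Dep route e₁ e₂` iff `e₂` immediately
follows `e₁` on some routing path. -/
def Dep {V E : Type*} (route : ∀ u w : V, u ≠ w → List E) (e₁ e₂ : E) : Prop :=
  ∃ (u w : V) (h : u ≠ w), [e₁, e₂] <:+: route u w h

/-- A routing scheme is deadlock-free iff its dependency relation is acyclic. -/
def DeadlockFree {V E : Type*} (route : ∀ u w : V, u ≠ w → List E) : Prop :=
  Irreflexive (Relation.TransGen (Dep route))

/-- `T` is a spanning in-tree rooted at `v`: it has exactly `|V| - 1` edges and every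
vertex other than `v` has a directed path to `v` using only edges of `T`. -/
def IsInTree {V E : Type*} [Fintype V] (src tgt : E → V) (v : V) (T : Finset E) : Prop :=
  T.card = Fintype.card V - 1 ∧ ∀ u : V, u ≠ v → ReachableVia src tgt ↑T u v

/-- `T` is a spanning out-tree rooted at `v`: it has exactly `|V| - 1` edges and every
vertex other than `v` is reachable from `v` by a directed path using only edges of `T`. -/
def IsOutTree {V E : Type*} [Fintype V] (src tgt : E → V) (v : V) (T : Finset E) : Prop :=
  T.card = Fintype.card V - 1 ∧ ∀ w : V, w ≠ v → ReachableVia src tgt ↑T v w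

/-- A linear order on `E` respects a routing scheme if `e₁ < e₂` whenever `e₂`
immediately follows `e₁` on some routing path. -/
def RespectsRouting {V E : Type*} (route : ∀ u w : V, u ≠ w → List E)
    (ord : LinearOrder E) : Prop :=
  ∀ e₁ e₂ : E, Dep route e₁ e₂ → ord.lt e₁ e₂

/-- The set of the `s` smallest edges of a linear order on `E`. -/
def smallestEdges {E : Type*} (ord : LinearOrder E) (s : ℕ) : Set E :=
  {e | {e' | ord.le e' e}.ncard ≤ s}

/-- `v` is a global attractor of the subgraph with edge set `A`: it is reachable from
every other vertex by a directed path using only edges of `A`. -/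
def IsGlobalAttractor {V E : Type*} (src tgt : E → V) (A : Set E) (v : V) : Prop :=
  ∀ u : V, u ≠ v → ReachableVia src tgt A u v

/-- The attraction number of a linear order on `E`: the least `s` such that the subgraph
consisting of the `s` smallest edges has a global attractor. -/
noncomputable def attractionNumber {V E : Type*} (src tgt : E → V) (ord : LinearOrder E) : ℕ :=
  sInf {s | ∃ v : V, IsGlobalAttractor src tgt (smallestEdges ord s) v}

/-- There is an edge of `A` from `u` to `w`. -/
def EdgeStep {V E : Type*} (src tgt : E → V) (A : Set E) (u w : V) : Prop :=
  ∃ e ∈ A, src e = u ∧ tgt e = w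

section Reachability

variable {V E : Type*} {src tgt : E → V} {A B : Set E} {u v w : V}

theorem IsPathFrom.cons {e : E} {p : List E} (hp : IsPathFrom src tgt (tgt e) w p) :
    IsPathFrom src tgt (src e) w (e :: p) := by
  obtain ⟨hne, hc, hh, hl⟩ := hp
  cases p with
  | nil => exact absurd rfl hne
  | cons a l =>
    refine ⟨by simp, ?_, by simp, by simpa using hl⟩
    simp only [List.head?_cons, Option.map_some, Option.some.injEq] at hh
    exact List.isChain_cons_cons.2 ⟨hh.symm, hc⟩

theorem transGen_edgeStep_of_isPathFrom {p : List E} (hA : ∀ e ∈ p, e ∈ A)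
    (hp : IsPathFrom src tgt u w p) : Relation.TransGen (EdgeStep src tgt A) u w := by
  induction p generalizing u with
  | nil => exact absurd rfl hp.1
  | cons e l ih =>
    obtain ⟨-, hc, hh, hl⟩ := hp
    simp only [List.head?_cons, Option.map_some, Option.some.injEq] at hh
    cases l with
    | nil => exact .single ⟨e, hA e (by simp), hh, by simpa using hl⟩
    | cons a l =>
      obtain ⟨hea, hc⟩ := List.isChain_cons_cons.1 hc
      refine .head ⟨e, hA e (by simp), hh, rfl⟩
        (ih (fun x hx => hA x (List.mem_cons_of_mem _ hx)) ⟨by simp, hc, ?_, ?_⟩)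
      · simp [hea]
      · simpa using hl

theorem reachableVia_iff_transGen :
    ReachableVia src tgt A u w ↔ Relation.TransGen (EdgeStep src tgt A) u w := by
  refine ⟨fun ⟨p, hA, hp⟩ => transGen_edgeStep_of_isPathFrom hA hp, fun h => ?_⟩
  induction h using Relation.TransGen.head_induction_on with
  | single h =>
    obtain ⟨e, he, rfl, rfl⟩ := h
    exact ⟨[e], by simpa using he, by simp, List.isChain_singleton _, by simp, by simp⟩
  | head h _ ih =>
    obtain ⟨e, he, rfl, rfl⟩ := h
    obtain ⟨p, hA, hp⟩ := ih
    exact ⟨e :: p, by simpa [he] using hA, hp.cons⟩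

theorem ReachableVia.mono (hAB : A ⊆ B) (h : ReachableVia src tgt A u w) :
    ReachableVia src tgt B u w :=
  let ⟨p, hA, hp⟩ := h
  ⟨p, fun e he => hAB (hA e he), hp⟩

theorem ReachableVia.exists_mem_src_eq (h : ReachableVia src tgt A u w) :
    ∃ e ∈ A, src e = u := by
  obtain ⟨x, ⟨e, he, hu, -⟩, -⟩ :=
    Relation.TransGen.head'_iff.1 (reachableVia_iff_transGen.1 h)
  exact ⟨e, he, hu⟩

theorem IsGlobalAttractor.mono (hAB : A ⊆ B) (h : IsGlobalAttractor src tgt A v) :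
    IsGlobalAttractor src tgt B v :=
  fun u hu => (h u hu).mono hAB

/-- Removing an edge leaving a global attractor keeps it a global attractor. -/
theorem IsGlobalAttractor.diff_singleton {f : E} (h : IsGlobalAttractor src tgt A (src f)) :
    IsGlobalAttractor src tgt (A \ {f}) (src f) := by
  have key : ∀ u, Relation.TransGen (EdgeStep src tgt A) u (src f) →
      u = src f ∨ Relation.TransGen (EdgeStep src tgt (A \ {f})) u (src f) := by
    intro u hu
    induction hu using Relation.TransGen.head_induction_on with
    | single h =>
      obtain ⟨e, he, rfl, ht⟩ := h
      by_cases hef : e = f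
      · exact .inl (hef ▸ rfl)
      · exact .inr (.single ⟨e, ⟨he, hef⟩, rfl, ht⟩)
    | head h _ ih =>
      obtain ⟨e, he, rfl, rfl⟩ := h
      by_cases hef : e = f
      · exact .inl (hef ▸ rfl)
      · have hstep : EdgeStep src tgt (A \ {f}) (src e) (tgt e) := ⟨e, ⟨he, hef⟩, rfl, rfl⟩
        rcases ih with ih | ih
        · exact .inr (.single (ih ▸ hstep))
        · exact .inr (.head hstep ih)
  exact fun u hu =>
    reachableVia_iff_transGen.2 ((key u (reachableVia_iff_transGen.1 (h u hu))).resolve_left hu)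

theorem IsGlobalAttractor.tgt_of_mem {f : E} (hf : f ∈ A) (h : IsGlobalAttractor src tgt A (src f)) :
    IsGlobalAttractor src tgt A (tgt f) := by
  have hstep : EdgeStep src tgt A (src f) (tgt f) := ⟨f, hf, rfl, rfl⟩
  intro u _
  rw [reachableVia_iff_transGen]
  by_cases hu : u = src f
  · exact hu ▸ .single hstep
  · exact (reachableVia_iff_transGen.1 (h u hu)).tail hstep

end Reachability

theorem Dep.tgt_eq_src {V E : Type*} {src tgt : E → V} {route : ∀ u w : V, u ≠ w → List E}
    (hroute : IsRouting src tgt route) {e₁ e₂ : E} (h : Dep route e₁ e₂) :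
    tgt e₁ = src e₂ := by
  obtain ⟨u, w, huw, l₁, l₂, hl⟩ := h
  have hc : List.IsChain (fun e₁ e₂ => tgt e₁ = src e₂) (route u w huw) := (hroute u w huw).2.1
  rw [← hl] at hc
  simpa using hc.left_of_append.right_of_append

section SmallestEdges

variable {E : Type*} [Finite E]

theorem mem_smallestEdges_of_le {ord : LinearOrder E} {s : ℕ} {a b : E} (hab : ord.le a b)
    (hb : b ∈ smallestEdges ord s) : a ∈ smallestEdges ord s :=
  (Set.ncard_le_ncard (fun _ hc => ord.le_trans _ _ _ hc hab) (Set.toFinite _)).trans hb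

theorem ncard_smallestEdges_le (ord : LinearOrder E) (s : ℕ) :
    (smallestEdges ord s).ncard ≤ s := by
  rcases (smallestEdges ord s).eq_empty_or_nonempty with h | h
  · simp [h]
  · obtain ⟨m, hm, hmax⟩ := Set.exists_max_image _ id (Set.toFinite _) h
    exact (Set.ncard_le_ncard hmax (Set.toFinite _)).trans hm

theorem smallestEdges_card (ord : LinearOrder E) :
    smallestEdges ord (Nat.card E) = Set.univ :=
  Set.eq_univ_of_forall fun _ => Set.ncard_le_card _

theorem subset_smallestEdges_ncard {ord : LinearOrder E} {B : Set E}
    (hB : ∀ a b, ord.le a b → b ∈ B → a ∈ B) : B ⊆ smallestEdges ord B.ncard :=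
  fun b hb => Set.ncard_le_ncard (fun a hab => hB a b hab hb) (Set.toFinite _)

end SmallestEdges

open Classical in
/-- The linear order obtained from `ord` by moving the elements of `B` to the bottom. -/
noncomputable abbrev moveToBottom {E : Type*} (ord : LinearOrder E) (B : Set E) : LinearOrder E :=
  LinearOrder.lift' (fun e => toLex (decide (e ∉ B), e))
    fun _ _ h => congrArg (fun x => (ofLex x).2) h

section MoveToBottom

variable {E : Type*} {ord : LinearOrder E} {B : Set E} {a b : E}

theorem moveToBottom_lt_iff :
    (moveToBottom ord B).lt a b ↔ (a ∈ B ∧ b ∉ B) ∨ ((a ∈ B ↔ b ∈ B) ∧ ord.lt a b) := by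
  classical
  change toLex (decide (a ∉ B), a) < toLex (decide (b ∉ B), b) ↔ _
  rw [Prod.Lex.toLex_lt_toLex]
  by_cases ha : a ∈ B <;> by_cases hb : b ∈ B <;> simp [ha, hb]

theorem mem_of_moveToBottom_le (hab : (moveToBottom ord B).le a b) (hb : b ∈ B) : a ∈ B := by
  by_contra ha
  exact ((moveToBottom ord B).lt_iff_le_not_ge b a).1 (moveToBottom_lt_iff.2 (.inl ⟨hb, ha⟩))
    |>.2 hab

end MoveToBottom

/-- An edge set that is closed under dependency predecessors and has a global attractor bounds
the attraction number of some order respecting the routing scheme. -/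
theorem exists_respectsRouting_attractionNumber_le {V E : Type*} [Finite E] {src tgt : E → V}
    {route : ∀ u w : V, u ≠ w → List E} {ord : LinearOrder E} (hresp : RespectsRouting route ord)
    {B : Set E} (hB : ∀ e₁ e₂, Dep route e₁ e₂ → e₂ ∈ B → e₁ ∈ B) {v : V}
    (hv : IsGlobalAttractor src tgt B v) :
    ∃ ord' : LinearOrder E, RespectsRouting route ord' ∧
      attractionNumber src tgt ord' ≤ B.ncard := by
  refine ⟨moveToBottom ord B, fun e₁ e₂ h => moveToBottom_lt_iff.2 ?_, Nat.sInf_le ⟨v, ?_⟩⟩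
  · have := hB e₁ e₂ h
    have := hresp e₁ e₂ h
    tauto
  · exact hv.mono (subset_smallestEdges_ncard fun _ _ => mem_of_moveToBottom_le)

theorem exists_isGlobalAttractor_attractionNumber {V E : Type*} [Nonempty V] [Finite E]
    {src tgt : E → V} (hconn : StronglyConnected src tgt) (ord : LinearOrder E) :
    ∃ v, IsGlobalAttractor src tgt (smallestEdges ord (attractionNumber src tgt ord)) v := by
  refine Nat.sInf_mem (s := {s | ∃ v, IsGlobalAttractor src tgt (smallestEdges ord s) v})
    ⟨Nat.card E, Classical.arbitrary V, fun u hu => ?_⟩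
  rw [smallestEdges_card]
  exact hconn _ _ hu

/-- If a routing-respecting linear order has minimal attraction number among all
linear orders respecting the (deadlock-free) routing scheme, then its attraction
subgraph has exactly one global attractor. -/
theorem minimal_order_unique_attractor
    {V E : Type*} [Fintype V] [Nonempty V] [Fintype E] (src tgt : E → V)
    (hloop : ∀ e : E, src e ≠ tgt e) (hconn : StronglyConnected src tgt)
    (route : ∀ u w : V, u ≠ w → List E)
    (hroute : IsRouting src tgt route) (hdf : DeadlockFree route)
    (ord : LinearOrder E) (hresp : RespectsRouting route ord)
    (hmin : ∀ ord' : LinearOrder E, RespectsRouting route ord' →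
      attractionNumber src tgt ord ≤ attractionNumber src tgt ord') :
    ∃! v : V,
      IsGlobalAttractor src tgt (smallestEdges ord (attractionNumber src tgt ord)) v := by
  obtain ⟨v, hv⟩ := exists_isGlobalAttractor_attractionNumber hconn ord
  refine ⟨v, hv, fun w hw => ?_⟩
  by_contra hwv
  set A := smallestEdges ord (attractionNumber src tgt ord)
  obtain ⟨e, he, rfl⟩ := (hv w hwv).exists_mem_src_eq
  -- The largest edge of `A` leaving a global attractor has no dependency successor in `A`.
  obtain ⟨f, ⟨hfA, hf⟩, hmax⟩ := Set.exists_max_image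
    {f | f ∈ A ∧ IsGlobalAttractor src tgt A (src f)} id (Set.toFinite _) ⟨e, he, hw⟩
  have hclosed : ∀ e₁ e₂, Dep route e₁ e₂ → e₂ ∈ A \ {f} → e₁ ∈ A \ {f} := by
    rintro e₁ e₂ h ⟨h₂, -⟩
    have hlt := hresp e₁ e₂ h
    refine ⟨mem_smallestEdges_of_le (le_of_lt hlt) h₂, ?_⟩
    rintro rfl
    exact (not_le_of_gt hlt) (hmax e₂ ⟨h₂, Dep.tgt_eq_src hroute h ▸ hf.tgt_of_mem hfA⟩)
  obtain ⟨ord', hresp', hle⟩ :=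
    exists_respectsRouting_attractionNumber_le hresp hclosed hf.diff_singleton
  have hlt := Set.ncard_sdiff_singleton_lt_of_mem hfA (Set.toFinite _)
  have : A.ncard ≤ attractionNumber src tgt ord := ncard_smallestEdges_le ord _
  have := hmin ord' hresp'
  omega
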